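/- arXiv:2004.11271 — 2 statements merged into one kernel-verified Lean document; each statement's English description precedes it below -/
import Mathlib

section
/- Let u ∈ C_c^∞(ℝ^n; ℝ^n) be a solenoidal (divergence-free) vector field. Then there exists a family (u_ε)_{ε>0} of vector fields u_ε ∈ C_c^∞(ℝ^n; ℝ^n) such that: (i) supp u_ε ⊂ supp u for all ε; (ii) det(Id + ε ∇u_ε(x)) = 1 for every x ∈ ℝ^n and every ε; and (iii) for every k ∈ ℕ, the derivatives of u_ε up to order k converge uniformly on ℝ^n to those of u as ε → 0, i.e. ‖u_ε − u‖_{C^k} → 0. -/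
open MeasureTheory Filter Matrix

noncomputable def frobSq {n : ℕ} (X : Matrix (Fin n) (Fin n) ℝ) : ℝ := ∑ i, ∑ j, (X i j)^2
noncomputable def frob {n : ℕ} (X : Matrix (Fin n) (Fin n) ℝ) : ℝ := Real.sqrt (frobSq X)
noncomputable def msym {n : ℕ} (X : Matrix (Fin n) (Fin n) ℝ) : Matrix (Fin n) (Fin n) ℝ :=
  (1/2 : ℝ) • (X + Xᵀ)
noncomputable def mdev {n : ℕ} (X : Matrix (Fin n) (Fin n) ℝ) : Matrix (Fin n) (Fin n) ℝ :=
  X - (X.trace / n) • (1 : Matrix (Fin n) (Fin n) ℝ)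
noncomputable def mils {n : ℕ} (X : Matrix (Fin n) (Fin n) ℝ) : Matrix (Fin n) (Fin n) ℝ :=
  msym X - (X.trace / n) • (1 : Matrix (Fin n) (Fin n) ℝ)

/-- Matrix exponential, defined by its power series. -/
noncomputable def mexp {n : ℕ} (A : Matrix (Fin n) (Fin n) ℝ) : Matrix (Fin n) (Fin n) ℝ :=
  ∑' k : ℕ, ((k.factorial : ℝ)⁻¹) • A ^ k

/-- The eigenvalues of a symmetric real matrix, listed in ascending order
(and junk value `0` if the matrix is not symmetric). -/
noncomputable def sortedEig {n : ℕ} (A : Matrix (Fin n) (Fin n) ℝ) : Fin n → ℝ :=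
  if hA : A.IsHermitian then fun i => hA.eigenvalues (Tuple.sort hA.eigenvalues i) else 0

/-- The singular values of a real square matrix in ascending order. -/
noncomputable def singVals {n : ℕ} (X : Matrix (Fin n) (Fin n) ℝ) : Fin n → ℝ :=
  fun i => Real.sqrt (sortedEig (Xᵀ * X) i)

/-- The Jacobian matrix of a map `ℝ^n → ℝ^n`. -/
noncomputable def jac {n : ℕ} (u : EuclideanSpace ℝ (Fin n) → EuclideanSpace ℝ (Fin n))
    (x : EuclideanSpace ℝ (Fin n)) : Matrix (Fin n) (Fin n) ℝ :=
  fun i j => fderiv ℝ u x (EuclideanSpace.single j 1) i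

open scoped Topology ContDiff

universe u

theorem hasDerivAt_det {n : ℕ} {M : ℝ → Matrix (Fin n) (Fin n) ℝ}
    {A : Matrix (Fin n) (Fin n) ℝ} {t : ℝ}
    (h : ∀ i j, HasDerivAt (fun s => M s i j) ((A * M t) i j) t) :
    HasDerivAt (fun s => (M s).det) (A.trace * (M t).det) t := by
  have key : HasDerivAt (fun s => (M s).det)
      (∑ i, ((M t).updateRow i ((A * M t) i)).det) t := by
    have hdet : (fun s => (M s).det) =
        fun s => ∑ σ : Equiv.Perm (Fin n), ((Equiv.Perm.sign σ : ℤ) : ℝ) * ∏ i, M s i (σ i) := by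
      funext s
      rw [← det_transpose, det_apply']
      rfl
    rw [hdet]
    have h1 := HasDerivAt.fun_sum (u := (Finset.univ : Finset (Equiv.Perm (Fin n))))
      fun σ _ => (HasDerivAt.fun_finsetProd (u := (Finset.univ : Finset (Fin n)))
        fun i _ => h i (σ i)).const_mul (((Equiv.Perm.sign σ : ℤ) : ℝ))
    refine h1.congr_deriv ?_
    simp_rw [← det_transpose (updateRow _ _ _), det_apply', transpose_apply, Finset.mul_sum]
    rw [Finset.sum_comm]
    refine Finset.sum_congr rfl fun i _ => Finset.sum_congr rfl fun σ _ => ?_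
    rw [← Finset.mul_prod_erase Finset.univ _ (Finset.mem_univ i), updateRow_self, smul_eq_mul,
      mul_comm (∏ j ∈ _, _)]
    congr 2
    refine Finset.prod_congr rfl fun j hj => ?_
    rw [updateRow_ne (Finset.ne_of_mem_erase hj)]
  refine key.congr_deriv ?_
  rw [trace, Finset.sum_mul]
  refine Finset.sum_congr rfl fun i _ => ?_
  have : (A * M t) i = ∑ k, A i k • (M t) k := by
    ext j; simp [mul_apply]
  rw [this, det_updateRow_sum, smul_eq_mul, diag_apply]

/-- Pointwise application of a continuous family of operators to a continuous curve. -/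
noncomputable def ContinuousMap.applyCLM {K E F : Type*} [TopologicalSpace K] [CompactSpace K]
    [NormedAddCommGroup E] [NormedSpace ℝ E] [NormedAddCommGroup F] [NormedSpace ℝ F] :
    C(K, E →L[ℝ] F) →L[ℝ] C(K, E) →L[ℝ] C(K, F) :=
  LinearMap.mkContinuous₂
    (LinearMap.mk₂ ℝ (fun (A : C(K, E →L[ℝ] F)) (f : C(K, E)) =>
      (⟨fun t => A t (f t), A.continuous.clm_apply f.continuous⟩ : C(K, F)))
      (fun _ _ _ => by ext; simp) (fun _ _ _ => by ext; simp)
      (fun _ _ _ => by ext; simp) (fun _ _ _ => by ext; simp))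
    1 fun A f => by
      rw [ContinuousMap.norm_le _ (by positivity), one_mul]
      exact fun t => ((A t).le_opNorm _).trans (by
        gcongr
        · exact A.norm_coe_le_norm t
        · exact f.norm_coe_le_norm t)

theorem ContinuousMap.hasFDerivAt_comp_left {K E F : Type*} [TopologicalSpace K] [CompactSpace K]
    [NormedAddCommGroup E] [NormedSpace ℝ E] [NormedAddCommGroup F] [NormedSpace ℝ F]
    (g : C(E, F)) (g' : C(E, E →L[ℝ] F)) (hg : ∀ x, HasFDerivAt g (g' x) x) (f : C(K, E)) :
    HasFDerivAt (fun h : C(K, E) => g.comp h) (applyCLM (g'.comp f)) f := by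
  rw [hasFDerivAt_iff_isLittleO_nhds_zero, Asymptotics.isLittleO_iff]
  intro c hc
  have hcont : Continuous fun h : C(K, E) => g'.comp h := g'.continuous_postcomp
  obtain ⟨δ, hδ, H⟩ := (Metric.continuous_iff (α := C(K, E)) (β := C(K, E →L[ℝ] F))).1 hcont f c hc
  filter_upwards [Metric.ball_mem_nhds 0 hδ] with h hh
  rw [mem_ball_zero_iff] at hh
  rw [ContinuousMap.norm_le _ (by positivity)]
  intro t
  have hb : ∀ e ∈ Metric.ball (f t) δ, ‖g' e - g' (f t)‖ ≤ c := by
    intro e he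
    have h1 := H (f + ContinuousMap.const K (e - f t)) (by
      rw [dist_eq_norm, add_sub_cancel_left]
      rw [mem_ball_iff_norm] at he
      exact lt_of_le_of_lt ((ContinuousMap.norm_le _ (norm_nonneg _)).2 fun _ => le_rfl) he)
    have h2 := (ContinuousMap.dist_apply_le_dist t).trans h1.le
    simpa [dist_eq_norm] using h2
  have := (convex_ball (f t) δ).norm_image_sub_le_of_norm_hasFDerivWithin_le'
    (fun x _ => (hg x).hasFDerivWithinAt) hb (Metric.mem_ball_self hδ) (y := f t + h t)
    (by simpa using (h.norm_coe_le_norm t).trans_lt hh)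
  rw [add_sub_cancel_left] at this
  refine this.trans ?_
  gcongr
  exact h.norm_coe_le_norm t

theorem ContinuousMap.contDiff_comp_left {K : Type*} {E F : Type u}
    [TopologicalSpace K] [CompactSpace K]
    [NormedAddCommGroup E] [NormedSpace ℝ E] [NormedAddCommGroup F] [NormedSpace ℝ F]
    (g : C(E, F)) (hg : ContDiff ℝ ∞ g) : ContDiff ℝ ∞ (fun h : C(K, E) => g.comp h) := by
  rw [contDiff_infty]
  intro m
  induction m generalizing F with
  | zero => exact contDiff_zero.2 g.continuous_postcomp
  | succ m ih =>
    have hd := contDiff_infty_iff_fderiv.1 hg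
    let g' : C(E, E →L[ℝ] F) := ⟨fderiv ℝ g, hd.2.continuous⟩
    rw [Nat.cast_add, Nat.cast_one, contDiff_succ_iff_hasFDerivAt]
    refine ⟨fun f => applyCLM (g'.comp f), ?_, fun f =>
      hasFDerivAt_comp_left g g' (fun x => (hd.1 x).hasFDerivAt) f⟩
    exact ContDiff.comp (g := applyCLM (K := K) (E := E) (F := F))
      (ContinuousLinearMap.contDiff _) (ih g' hd.2)

/-- The fixed points of a smooth family of contractions depend smoothly on the parameter. -/
theorem contDiffAt_of_fixedPoint {P X : Type*} [NormedAddCommGroup P] [NormedSpace ℝ P]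
    [CompleteSpace P] [NormedAddCommGroup X] [NormedSpace ℝ X] [CompleteSpace X]
    {Φ : P × X → X} {Z : P → X} {p : P} (hΦ : ContDiff ℝ ∞ Φ)
    (hc : ∀ᶠ q in 𝓝 p, ∃ k, ContractingWith k fun z => Φ (q, z))
    (hZ : ∀ᶠ q in 𝓝 p, Φ (q, Z q) = Z q) : ContDiffAt ℝ ∞ Z p := by
  have hF : ContDiff ℝ ∞ fun v : P × X => v.2 - Φ v := contDiff_snd.sub hΦ
  obtain ⟨k, hk⟩ := hc.self_of_nhds
  have hne : (∞ : WithTop ℕ∞) ≠ 0 := by simp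
  have hinv : (fderiv ℝ (fun v : P × X => v.2 - Φ v) (p, Z p) ∘L
      .inr ℝ P X).IsInvertible := by
    have hdΦ := (hΦ.differentiable hne (p, Z p)).hasFDerivAt
    set D := fderiv ℝ Φ (p, Z p) ∘L .inr ℝ P X
    have h1 : fderiv ℝ (fun v : P × X => v.2 - Φ v) (p, Z p) ∘L .inr ℝ P X = 1 - D := by
      rw [(hasFDerivAt_snd.fun_sub hdΦ).fderiv]
      ext; simp [D]
    have h2 : HasFDerivAt (fun z => Φ (p, z)) D (Z p) :=
      hdΦ.comp (Z p) (hasFDerivAt_prodMk_right p (Z p))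
    have h3 : ‖D‖ < 1 := (h2.le_of_lipschitz hk.2).trans_lt (by exact_mod_cast hk.1)
    rw [h1]
    refine ⟨ContinuousLinearEquiv.unitsEquiv ℝ X (Units.oneSub D h3), ?_⟩
    ext; simp
  have hcd := hF.contDiffAt (x := (p, Z p))
  refine (hcd.contDiffAt_implicitFunction hne hinv).congr_of_eventuallyEq ?_
  filter_upwards [hcd.eventually_apply_implicitFunction hne hinv, hc, hZ] with q hq ⟨k, hk⟩ hZq
  have hZp := hZ.self_of_nhds
  rw [hZp, sub_self, sub_eq_zero] at hq
  exact hk.fixedPoint_unique' hZq hq.symm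

theorem norm_integral_projIcc_le {E : Type*} [NormedAddCommGroup E] [NormedSpace ℝ E]
    (f : C(unitInterval, E)) (t : unitInterval) :
    ‖∫ s in (0 : ℝ)..t, f (Set.projIcc (0 : ℝ) 1 zero_le_one s)‖ ≤ ‖f‖ := by
  refine (intervalIntegral.norm_integral_le_of_norm_le_const (C := ‖f‖)
    fun s _ => f.norm_coe_le_norm _).trans ?_
  rw [sub_zero, abs_of_nonneg t.2.1]
  exact mul_le_of_le_one_right (norm_nonneg _) t.2.2

/-- Integration from `0`, as an operator on curves defined on the unit interval. -/
noncomputable def primitiveCLM (E : Type*) [NormedAddCommGroup E] [NormedSpace ℝ E] :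
    C(unitInterval, E) →L[ℝ] C(unitInterval, E) :=
  have hf (f : C(unitInterval, E)) :
      Continuous fun s => f (Set.projIcc (0 : ℝ) 1 zero_le_one s) :=
    f.continuous.comp continuous_projIcc
  LinearMap.mkContinuous
    { toFun f := ⟨fun t => ∫ s in (0 : ℝ)..t, f (Set.projIcc (0 : ℝ) 1 zero_le_one s),
        (intervalIntegral.continuous_primitive (fun _ _ => (hf f).intervalIntegrable _ _) 0).comp
          continuous_subtype_val⟩
      map_add' f g := by
        ext t
        exact intervalIntegral.integral_add ((hf f).intervalIntegrable _ _)
          ((hf g).intervalIntegrable _ _)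
      map_smul' c f := by
        ext t
        exact intervalIntegral.integral_smul c _ }
    1 fun f => by
      rw [ContinuousMap.norm_le _ (by positivity), one_mul]
      exact norm_integral_projIcc_le f

theorem primitiveCLM_apply {E : Type*} [NormedAddCommGroup E] [NormedSpace ℝ E]
    (f : C(unitInterval, E)) (t : unitInterval) :
    primitiveCLM E f t = ∫ s in (0 : ℝ)..t, f (Set.projIcc (0 : ℝ) 1 zero_le_one s) := rfl

theorem norm_primitiveCLM_apply_le {E : Type*} [NormedAddCommGroup E] [NormedSpace ℝ E]
    (f : C(unitInterval, E)) : ‖primitiveCLM E f‖ ≤ ‖f‖ := by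
  rw [ContinuousMap.norm_le _ (norm_nonneg _)]
  exact norm_integral_projIcc_le f

/-- The iterated derivatives of a smooth family depend smoothly on the parameter as well. -/
theorem ContDiffAt.iteratedFDeriv_family {P E F : Type*} [NormedAddCommGroup P] [NormedSpace ℝ P]
    [NormedAddCommGroup E] [NormedSpace ℝ E] [NormedAddCommGroup F] [NormedSpace ℝ F]
    {V : P → E → F} {q : P × E} (i : ℕ)
    (hV : ContDiffAt ℝ ∞ (fun q : P × E => V q.1 q.2) q) :
    ContDiffAt ℝ ∞ (fun q : P × E => iteratedFDeriv ℝ i (V q.1) q.2) q := by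
  induction i with
  | zero =>
    simp only [iteratedFDeriv_zero_eq_comp]
    exact ContDiffAt.comp q (continuousMultilinearCurryFin0 ℝ E F).symm.contDiff.contDiffAt hV
  | succ i ih =>
    simp only [iteratedFDeriv_succ_eq_comp_left]
    have hc : ContDiff ℝ ∞
        (continuousMultilinearCurryLeftEquiv ℝ (fun _ : Fin (i + 1) => E) F).symm :=
      LinearIsometryEquiv.contDiff _
    refine hc.contDiffAt.comp q ?_
    refine ContDiffAt.fderiv (f := fun q : P × E => iteratedFDeriv ℝ i (V q.1)) (n := ∞) ?_
      contDiffAt_snd le_rfl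
    exact ContDiffAt.comp (q, q.2) (f := fun r : (P × E) × E => (r.1.1, r.2)) ih (by fun_prop)

theorem det_eq_one_of_variational {n : ℕ} {ε : ℝ} (A : unitInterval → Matrix (Fin n) (Fin n) ℝ)
    (hA : ∀ t, (A t).trace = 0) (B G : Fin n → C(unitInterval, EuclideanSpace ℝ (Fin n)))
    (hB : ∀ j, B j = ContinuousMap.const _ (EuclideanSpace.single j 1) +
      ε • primitiveCLM (EuclideanSpace ℝ (Fin n)) (G j))
    (hG : ∀ j t i, ε * G j t i = ∑ k, A t i k * B j t k) :
    (Matrix.of fun i j => B j 1 i).det = 1 := by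
  set E := EuclideanSpace ℝ (Fin n)
  let g (j : Fin n) (s : ℝ) : E := G j (Set.projIcc 0 1 zero_le_one s)
  have hg (j) : Continuous (g j) := (G j).continuous.comp continuous_projIcc
  let M (s : ℝ) : Matrix (Fin n) (Fin n) ℝ := Matrix.of fun i j =>
    (EuclideanSpace.single j (1 : ℝ) + ε • ∫ r in (0 : ℝ)..s, g j r : E) i
  have hMB (t : unitInterval) (i j) : M t i j = B j t i := by
    rw [hB]; rfl
  have hM (s : ℝ) (hs : s ∈ Set.Icc (0 : ℝ) 1) : HasDerivAt (fun s => (M s).det) 0 s := by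
    have hd := hasDerivAt_det (M := M) (A := A ⟨s, hs⟩) (t := s) fun i j => by
      have h1 : HasDerivAt (fun s => (EuclideanSpace.single j (1 : ℝ) +
          ε • ∫ r in (0 : ℝ)..s, g j r : E)) (ε • g j s) s :=
        (((hg j).integral_hasStrictDerivAt 0 s).hasDerivAt.const_smul ε).const_add _
      have h2 := (EuclideanSpace.proj (𝕜 := ℝ) i).hasFDerivAt.comp_hasDerivAt s h1
      refine h2.congr_deriv ?_
      have h3 := hG j ⟨s, hs⟩ i
      rw [mul_apply]
      simp_rw [fun k => hMB ⟨s, hs⟩ k j]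
      rw [← h3]
      simp [g, Set.projIcc_of_mem zero_le_one hs]
    rwa [hA, zero_mul] at hd
  have hc := constant_of_has_deriv_right_zero (f := fun s => (M s).det) (a := 0) (b := 1)
    (fun s hs => (hM s hs).continuousAt.continuousWithinAt)
    (fun s hs => (hM s (Set.Ico_subset_Icc_self hs)).hasDerivWithinAt) 1 (by simp)
  have h0 : M 0 = 1 := by
    ext i j
    simp [M, Matrix.one_apply]
  have h1 : M 1 = Matrix.of fun i j => B j 1 i := by
    ext i j
    exact hMB 1 i j
  rw [← h1]
  simpa [h0] using hc

section Flow

variable {E : Type} [NormedAddCommGroup E] [NormedSpace ℝ E]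

/-- The Picard map whose fixed point `z` is the rescaled displacement `(y (ε t) - x) / ε` of the
flow `y` of `u` issued from `x`; the parameter is `(ε, x)`. -/
noncomputable def displacementMap (u : C(E, E)) (q : (ℝ × E) × C(unitInterval, E)) :
    C(unitInterval, E) :=
  primitiveCLM E (u.comp (ContinuousMap.const _ q.1.2 + q.1.1 • q.2))

theorem contDiff_displacementMap (u : C(E, E)) (hu : ContDiff ℝ ∞ u) :
    ContDiff ℝ ∞ (displacementMap u) := by
  refine (primitiveCLM E).contDiff.comp
    ((ContinuousMap.contDiff_comp_left (K := unitInterval) u hu).comp (ContDiff.add ?_ ?_))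
  · exact (ContinuousLinearMap.const (R := ℝ) (M := E) unitInterval).contDiff.comp
      (contDiff_snd.comp contDiff_fst)
  · exact (contDiff_fst.comp contDiff_fst).smul contDiff_snd

theorem contractingWith_displacementMap (u : C(E, E)) {L : NNReal} (hL : LipschitzWith L u)
    {p : ℝ × E} (hp : L * ‖p.1‖₊ < 1) :
    ContractingWith (L * ‖p.1‖₊) fun z => displacementMap u (p, z) := by
  refine ⟨hp, LipschitzWith.of_dist_le_mul fun z w => ?_⟩
  rw [dist_eq_norm, displacementMap, displacementMap, ← map_sub]
  refine (norm_primitiveCLM_apply_le _).trans ?_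
  rw [ContinuousMap.norm_le _ (by positivity)]
  intro t
  have h1 := hL.dist_le_mul (p.2 + p.1 • z t) (p.2 + p.1 • w t)
  rw [dist_add_left, dist_smul₀] at h1
  refine (le_of_eq_of_le ?_ h1).trans ?_
  · rw [dist_eq_norm]; rfl
  · push_cast
    rw [mul_assoc]
    gcongr
    exact ContinuousMap.dist_apply_le_dist t

/-- A smooth Lipschitz field has a smooth family of fixed points of its Picard maps. -/
theorem exists_displacement [CompleteSpace E] (u : C(E, E)) (hu : ContDiff ℝ ∞ u) {L : NNReal}
    (hL : LipschitzWith L u) :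
    ∃ Z : ℝ × E → C(unitInterval, E), ∀ p, L * ‖p.1‖₊ < 1 →
      ContDiffAt ℝ ∞ Z p ∧ displacementMap u (p, Z p) = Z p ∧
      ∀ z, displacementMap u (p, z) = z → z = Z p := by
  have h (p : ℝ × E) : ∃ z, L * ‖p.1‖₊ < 1 → displacementMap u (p, z) = z := by
    by_cases hp : L * ‖p.1‖₊ < 1
    · exact ⟨_, fun _ => (contractingWith_displacementMap u hL hp).fixedPoint_isFixedPt⟩
    · exact ⟨0, fun h => absurd h hp⟩
  choose Z hZ using h
  refine ⟨Z, fun p hp => ⟨?_, hZ p hp, fun z hz =>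
    (contractingWith_displacementMap u hL hp).fixedPoint_unique' hz (hZ p hp)⟩⟩
  have hev : ∀ᶠ q : ℝ × E in 𝓝 p, L * ‖q.1‖₊ < 1 :=
    (isOpen_lt (by fun_prop) continuous_const).mem_nhds hp
  exact contDiffAt_of_fixedPoint (contDiff_displacementMap u hu)
    (hev.mono fun q hq => ⟨_, contractingWith_displacementMap u hL hq⟩)
    (hev.mono fun q hq => hZ q hq)

/-- The variational equation satisfied by the derivative of the displacement in the initial
point. -/
theorem fderiv_displacement (u : C(E, E)) (hu : ContDiff ℝ ∞ u) {ε : ℝ} {x : E}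
    {ζ : E → C(unitInterval, E)} (hζ : ∀ y, displacementMap u ((ε, y), ζ y) = ζ y)
    (hd : DifferentiableAt ℝ ζ x) (v : E) :
    ∃ G : C(unitInterval, E), fderiv ℝ ζ x v = primitiveCLM E G ∧ ∀ t, G t =
      fderiv ℝ u (x + ε • ζ x t) (v + ε • fderiv ℝ ζ x v t) := by
  have hd' := contDiff_infty_iff_fderiv.1 hu
  let u' : C(E, E →L[ℝ] E) := ⟨fderiv ℝ u, hd'.2.continuous⟩
  let c := ContinuousLinearMap.const (R := ℝ) (M := E) unitInterval
  have h1 : HasFDerivAt (fun y => c y + ε • ζ y) (c + ε • fderiv ℝ ζ x) x :=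
    c.hasFDerivAt.add (hd.hasFDerivAt.const_smul ε)
  have h2 := (ContinuousMap.hasFDerivAt_comp_left u u'
    (fun x => (hd'.1 x).hasFDerivAt) (c x + ε • ζ x)).comp x h1
  have h3 := (primitiveCLM E).hasFDerivAt.comp x h2
  have h4 : fderiv ℝ ζ x = _ := (h3.congr_of_eventuallyEq
    (Filter.Eventually.of_forall fun y => (hζ y).symm)).fderiv
  refine ⟨ContinuousMap.applyCLM (u'.comp (c x + ε • ζ x)) (c v + ε • fderiv ℝ ζ x v), ?_,
    fun t => rfl⟩
  exact DFunLike.congr_fun h4 v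

end Flow

/-- Approximation of a smooth compactly supported divergence-free vector field `u` by
fields `U ε` whose rescaled deformations `Id + ε ∇(U ε)` are exactly volume preserving,
with convergence in every `C^k` norm as `ε → 0`. -/
theorem stmt3 (n : ℕ) (u : EuclideanSpace ℝ (Fin n) → EuclideanSpace ℝ (Fin n))
    (hu : ContDiff ℝ (⊤ : ℕ∞) u) (hsupp : HasCompactSupport u)
    (hdiv : ∀ x, (jac u x).trace = 0) :
    ∃ U : ℝ → EuclideanSpace ℝ (Fin n) → EuclideanSpace ℝ (Fin n),
      (∀ ε : ℝ, 0 < ε →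
        ContDiff ℝ (⊤ : ℕ∞) (U ε) ∧ HasCompactSupport (U ε) ∧
        tsupport (U ε) ⊆ tsupport u ∧
        ∀ x, (1 + ε • jac (U ε) x).det = 1) ∧
      (∀ k : ℕ, ∀ δ > (0 : ℝ), ∃ ε₀ > (0 : ℝ), ∀ ε : ℝ, 0 < ε → ε ≤ ε₀ →
        ∀ x, ∀ i ≤ k, ‖iteratedFDeriv ℝ i (U ε) x - iteratedFDeriv ℝ i u x‖ ≤ δ) := by
  obtain ⟨L, hL⟩ := hu.lipschitzWith_of_hasCompactSupport hsupp (by simp)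
  let u₀ : C(EuclideanSpace ℝ (Fin n), EuclideanSpace ℝ (Fin n)) := ⟨u, hu.continuous⟩
  obtain ⟨Z, hZ⟩ := exists_displacement u₀ hu (L := L) hL
  let V (ε : ℝ) (x : EuclideanSpace ℝ (Fin n)) : EuclideanSpace ℝ (Fin n) := Z (ε, x) 1
  have hev : ∀ᶠ ε : ℝ in 𝓝 0, L * ‖ε‖₊ < 1 :=
    (isOpen_lt (by fun_prop) continuous_const).mem_nhds (by simp)
  have hVjoint (q : ℝ × EuclideanSpace ℝ (Fin n)) (hq : L * ‖q.1‖₊ < 1) :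
      ContDiffAt ℝ ∞ (fun q : ℝ × EuclideanSpace ℝ (Fin n) => V q.1 q.2) q :=
    (ContinuousMap.evalCLM (M := EuclideanSpace ℝ (Fin n)) ℝ
      (1 : unitInterval)).contDiff.contDiffAt.comp q (hZ q hq).1
  have hVsupp (ε : ℝ) (hε : L * ‖ε‖₊ < 1) : tsupport (V ε) ⊆ tsupport u := by
    refine closure_mono fun x hx hux => hx ?_
    have h0 : (0 : C(unitInterval, EuclideanSpace ℝ (Fin n))) = Z (ε, x) := by
      refine (hZ (ε, x) hε).2.2 0 ?_
      have : u₀.comp (ContinuousMap.const unitInterval x +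
          ε • (0 : C(unitInterval, EuclideanSpace ℝ (Fin n)))) = 0 := by
        ext1 t
        simpa [u₀] using hux
      simp only [displacementMap]
      rw [this, map_zero]
    simp [V, ← h0]
  have hV0 : V 0 = u := by
    funext x
    have h0 := (hZ (0, x) (by simp)).2.1
    have h1 := DFunLike.congr_fun h0 1
    rw [displacementMap, primitiveCLM_apply] at h1
    simpa [u₀] using h1.symm
  have hVdet (ε : ℝ) (hε : L * ‖ε‖₊ < 1) (x) : (1 + ε • jac (V ε) x).det = 1 := by
    have hd : DifferentiableAt ℝ (fun y => Z (ε, y)) x :=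
      ((hZ (ε, x) hε).1.comp x (f := fun y => (ε, y)) (by fun_prop)).differentiableAt (by simp)
    choose G hG1 hG2 using fderiv_displacement u₀ hu (fun y => (hZ (ε, y) hε).2.1) hd
    let B (j : Fin n) : C(unitInterval, EuclideanSpace ℝ (Fin n)) :=
      ContinuousMap.const _ (EuclideanSpace.single j 1) +
        ε • fderiv ℝ (fun y => Z (ε, y)) x (EuclideanSpace.single j 1)
    have hdet := det_eq_one_of_variational (ε := ε)
      (fun t => ε • jac u (x + ε • Z (ε, x) t))
      (fun t => by rw [trace_smul, hdiv, smul_zero]) B (fun j => G (EuclideanSpace.single j 1))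
      (fun j => by rw [← hG1]) (fun j t i => by
        rw [hG2]
        change ε * fderiv ℝ u (x + ε • Z (ε, x) t) (B j t) i = _
        conv_lhs => rw [← (EuclideanSpace.basisFun (Fin n) ℝ).sum_repr (B j t)]
        simp [jac, Finset.mul_sum]
        exact Finset.sum_congr rfl fun k _ => by ring)
    rw [← hdet]
    congr 1
    ext i j
    have hVd : HasFDerivAt (V ε) ((ContinuousMap.evalCLM (M := EuclideanSpace ℝ (Fin n)) ℝ
        (1 : unitInterval)).comp (fderiv ℝ (fun y => Z (ε, y)) x)) x :=
      (ContinuousMap.evalCLM (M := EuclideanSpace ℝ (Fin n)) ℝ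
        (1 : unitInterval)).hasFDerivAt.comp x hd.hasFDerivAt
    simp [B, jac, hVd.fderiv, Matrix.one_apply]
  refine ⟨fun ε => if L * ‖ε‖₊ < 1 then V ε else 0, fun ε _ => ?_, fun k δ hδ => ?_⟩
  · by_cases hε : L * ‖ε‖₊ < 1
    · simp only [if_pos hε]
      refine ⟨contDiff_iff_contDiffAt.2 fun x => ?_,
        hsupp.of_isClosed_subset (isClosed_tsupport _) (hVsupp ε hε), hVsupp ε hε, hVdet ε hε⟩
      exact (hVjoint (ε, x) hε).comp x (f := fun y => (ε, y)) (by fun_prop)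
    · simp only [if_neg hε]
      refine ⟨contDiff_const, HasCompactSupport.zero, by simp [tsupport], fun x => ?_⟩
      have : jac (0 : EuclideanSpace ℝ (Fin n) → EuclideanSpace ℝ (Fin n)) x = 0 := by
        ext i j
        simp [jac]
      simp [this]
  · have hloc (i : ℕ) : ∀ᶠ ε in 𝓝 (0 : ℝ), ∀ x ∈ tsupport u,
        ‖iteratedFDeriv ℝ i (V ε) x - iteratedFDeriv ℝ i u x‖ ≤ δ := by
      refine hsupp.isCompact.eventually_forall_of_forall_eventually fun x _ => ?_
      have h1 := ((hVjoint (0, x) (by simp)).iteratedFDeriv_family i).continuousAt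
      have h2 : ContinuousAt (fun q : ℝ × EuclideanSpace ℝ (Fin n) =>
          iteratedFDeriv ℝ i u q.2) (0, x) :=
        ((hu.continuous_iteratedFDeriv (by exact_mod_cast le_top)).comp
          continuous_snd).continuousAt
      have h3 := (h1.sub h2).norm.tendsto.eventually_lt_const (u := δ) (by simpa [hV0] using hδ)
      exact h3.mono fun q hq => hq.le
    have hall : ∀ᶠ ε in 𝓝 (0 : ℝ), L * ‖ε‖₊ < 1 ∧ ∀ i ∈ Finset.range (k + 1), ∀ x ∈ tsupport u,
        ‖iteratedFDeriv ℝ i (V ε) x - iteratedFDeriv ℝ i u x‖ ≤ δ :=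
      hev.and ((Filter.eventually_all_finset _).2 fun i _ => hloc i)
    obtain ⟨r, hr, H⟩ := Metric.eventually_nhds_iff.1 hall
    refine ⟨r / 2, half_pos hr, fun ε hε hεr x i hi => ?_⟩
    obtain ⟨hεL, hε'⟩ := @H ε (by rw [Real.dist_eq, sub_zero, abs_of_pos hε]; linarith)
    simp only [if_pos hεL]
    by_cases hx : x ∈ tsupport u
    · exact hε' i (Finset.mem_range.2 (by lia)) x hx
    · have hz (w : EuclideanSpace ℝ (Fin n) → EuclideanSpace ℝ (Fin n))
          (hw : tsupport w ⊆ tsupport u) : iteratedFDeriv ℝ i w x = 0 :=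
        Function.notMem_support.1 fun h => hx (hw (support_iteratedFDeriv_subset i h))
      rw [hz _ (hVsupp ε hεL), hz u le_rfl, sub_zero, norm_zero]
      exact hδ.le
end

section
/- Let ρ₁, ρ₂, ρ₃ ∈ ℝ and let ρ₁(ε), ρ₂(ε), ρ₃(ε) be real-valued functions of ε > 0 with ρ_i(ε) → ρ_i as ε → 0 and ρ₁(ε) + ρ₂(ε) + ρ₃(ε) = 0 for all ε; set γ_{ε,i} := e^{ε ρ_i(ε)} and, for X ∈ ℝ^{3×3} with det X = 1, W_ε(X) := Σ_{i=1}^{3} σ_i(X)²/γ_{ε,i}² − 3. Then for every r > 0, sup { | ε^{-2} W_ε(exp(εZ)) − 2 Σ_{i=1}^{3} (λ_i(Z_sym) − ρ_i)² | : Z ∈ ℝ^{3×3}, tr Z = 0, |Z| ≤ r } → 0 as ε → 0. -/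
open MeasureTheory Filter Matrix

section SortedEigenvalues

variable {n : ℕ} {A : Matrix (Fin n) (Fin n) ℝ}

lemma sortedEig_eq (hA : A.IsHermitian) (i : Fin n) :
    sortedEig A i = hA.eigenvalues (Tuple.sort hA.eigenvalues i) := by
  rw [sortedEig, dif_pos hA]

lemma sortedEig_monotone (hA : A.IsHermitian) : Monotone (sortedEig A) := by
  have h : sortedEig A = hA.eigenvalues ∘ Tuple.sort hA.eigenvalues :=
    funext (sortedEig_eq hA)
  rw [h]
  exact Tuple.monotone_sort _

lemma sum_comp_sortedEig (hA : A.IsHermitian) (f : ℝ → ℝ) :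
    ∑ i, f (sortedEig A i) = ∑ i, f (hA.eigenvalues i) := by
  simp_rw [sortedEig_eq hA]
  exact Equiv.sum_comp (Tuple.sort hA.eigenvalues) fun i => f (hA.eigenvalues i)

lemma sum_sortedEig (hA : A.IsHermitian) : ∑ i, sortedEig A i = A.trace := by
  rw [sum_comp_sortedEig hA fun x => x, hA.trace_eq_sum_eigenvalues]
  simp

lemma sum_sortedEig_sq (hA : A.IsHermitian) : ∑ i, sortedEig A i ^ 2 = (A * A).trace := by
  rw [sum_comp_sortedEig hA fun x => x ^ 2]
  conv_rhs => rw [hA.spectral_theorem]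
  rw [← map_mul, Unitary.conjStarAlgAut_apply, Matrix.trace_mul_cycle]
  simp [Matrix.diagonal_mul_diagonal, Matrix.trace_diagonal, sq]

lemma exists_unit_dotProduct_mulVec_eq_sortedEig (hA : A.IsHermitian) (i : Fin n) :
    ∃ v : Fin n → ℝ, v ⬝ᵥ v = 1 ∧ v ⬝ᵥ A *ᵥ v = sortedEig A i := by
  set j := Tuple.sort hA.eigenvalues i
  have h1 : (hA.eigenvectorBasis j).ofLp ⬝ᵥ (hA.eigenvectorBasis j).ofLp = 1 := by
    have h := hA.eigenvectorBasis.orthonormal.1 j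
    rw [EuclideanSpace.norm_eq, Real.sqrt_eq_one] at h
    simpa [dotProduct, sq] using h
  refine ⟨hA.eigenvectorBasis j, h1, ?_⟩
  rw [hA.mulVec_eigenvectorBasis, dotProduct_smul, h1, sortedEig_eq hA]
  simp [j]

lemma exists_sortedEig_eq (hA : A.IsHermitian) (j : Fin n) :
    ∃ i, sortedEig A i = hA.eigenvalues j :=
  ⟨(Tuple.sort hA.eigenvalues).symm j, by simp [sortedEig_eq hA]⟩

lemma dotProduct_mulVec_eq_sum (hA : A.IsHermitian) (v : Fin n → ℝ) :
    ∃ w : Fin n → ℝ, w ⬝ᵥ w = v ⬝ᵥ v ∧ v ⬝ᵥ A *ᵥ v = ∑ i, hA.eigenvalues i * w i ^ 2 := by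
  set U : Matrix (Fin n) (Fin n) ℝ := (hA.eigenvectorUnitary : Matrix (Fin n) (Fin n) ℝ) with hU
  have hUU : U * Uᵀ = 1 := by
    have := Unitary.mul_star_self_of_mem hA.eigenvectorUnitary.2
    simpa [Matrix.star_eq_conjTranspose, conjTranspose_eq_transpose_of_trivial] using this
  have key : ∀ M : Matrix (Fin n) (Fin n) ℝ,
      v ⬝ᵥ (U * M * Uᵀ) *ᵥ v = (Uᵀ *ᵥ v) ⬝ᵥ M *ᵥ (Uᵀ *ᵥ v) := by
    intro M
    rw [← mulVec_mulVec, ← mulVec_mulVec, dotProduct_mulVec, ← mulVec_transpose]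
  refine ⟨Uᵀ *ᵥ v, ?_, ?_⟩
  · have h := key 1
    simpa [hUU] using h.symm
  · have h := key (diagonal hA.eigenvalues)
    have hs : A = U * diagonal hA.eigenvalues * Uᵀ := by
      have := hA.spectral_theorem
      rw [Unitary.conjStarAlgAut_apply] at this
      simpa [Matrix.star_eq_conjTranspose, conjTranspose_eq_transpose_of_trivial,
        Function.comp_def] using this
    rw [← hs] at h
    rw [h]
    simp only [dotProduct, mulVec_diagonal]
    exact Finset.sum_congr rfl fun i _ => by ring

lemma le_dotProduct_mulVec (hA : A.IsHermitian) {a : ℝ} (ha : ∀ i, a ≤ sortedEig A i)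
    (v : Fin n → ℝ) : a * (v ⬝ᵥ v) ≤ v ⬝ᵥ A *ᵥ v := by
  obtain ⟨w, hw, h⟩ := dotProduct_mulVec_eq_sum hA v
  rw [h, ← hw, dotProduct, Finset.mul_sum]
  refine Finset.sum_le_sum fun i _ => ?_
  obtain ⟨j, hj⟩ := exists_sortedEig_eq hA i
  rw [← hj, ← sq]
  exact mul_le_mul_of_nonneg_right (ha j) (sq_nonneg _)

lemma dotProduct_mulVec_le (hA : A.IsHermitian) {a : ℝ} (ha : ∀ i, sortedEig A i ≤ a)
    (v : Fin n → ℝ) : v ⬝ᵥ A *ᵥ v ≤ a * (v ⬝ᵥ v) := by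
  obtain ⟨w, hw, h⟩ := dotProduct_mulVec_eq_sum hA v
  rw [h, ← hw, dotProduct, Finset.mul_sum]
  refine Finset.sum_le_sum fun i _ => ?_
  obtain ⟨j, hj⟩ := exists_sortedEig_eq hA i
  rw [← hj, ← sq]
  exact mul_le_mul_of_nonneg_right (ha j) (sq_nonneg _)

lemma singVals_sq (X : Matrix (Fin n) (Fin n) ℝ) (i : Fin n) :
    singVals X i ^ 2 = sortedEig (Xᵀ * X) i := by
  have h : (Xᵀ * X).PosSemidef := by
    simpa [conjTranspose_eq_transpose_of_trivial] using posSemidef_conjTranspose_mul_self X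
  rw [singVals, Real.sq_sqrt]
  rw [sortedEig_eq h.1]
  exact h.eigenvalues_nonneg _

end SortedEigenvalues

lemma isHermitian_msym {n : ℕ} (Z : Matrix (Fin n) (Fin n) ℝ) : (msym Z).IsHermitian := by
  simp [IsHermitian, msym, conjTranspose_eq_transpose_of_trivial, transpose_add, add_comm]

section FrobeniusNorm

attribute [local instance] Matrix.frobeniusNormedRing Matrix.frobeniusNormedAlgebra

lemma norm_eq_frob {n : ℕ} (A : Matrix (Fin n) (Fin n) ℝ) : ‖A‖ = frob A := by
  rw [frobenius_norm_def, frob, frobSq, Real.sqrt_eq_rpow]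
  simp

lemma abs_apply_le_norm {n : ℕ} (A : Matrix (Fin n) (Fin n) ℝ) (i j : Fin n) :
    |A i j| ≤ ‖A‖ := by
  rw [norm_eq_frob, frob, frobSq]
  refine Real.abs_le_sqrt ?_
  calc A i j ^ 2 ≤ ∑ j, A i j ^ 2 :=
        Finset.single_le_sum (f := fun j => A i j ^ 2) (fun _ _ => sq_nonneg _) (Finset.mem_univ j)
    _ ≤ ∑ i, ∑ j, A i j ^ 2 :=
        Finset.single_le_sum (f := fun i => ∑ j, A i j ^ 2)
          (fun _ _ => Finset.sum_nonneg fun _ _ => sq_nonneg _) (Finset.mem_univ i)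

lemma abs_trace_le_norm {n : ℕ} (A : Matrix (Fin n) (Fin n) ℝ) : |A.trace| ≤ n * ‖A‖ := by
  calc |A.trace| ≤ ∑ i, |A i i| := Finset.abs_sum_le_sum_abs _ _
    _ ≤ ∑ _i : Fin n, ‖A‖ := Finset.sum_le_sum fun i _ => abs_apply_le_norm A i i
    _ = n * ‖A‖ := by simp

lemma abs_dotProduct_mulVec_le_norm {n : ℕ} (A : Matrix (Fin n) (Fin n) ℝ) {v : Fin n → ℝ}
    (hv : v ⬝ᵥ v = 1) : |v ⬝ᵥ A *ᵥ v| ≤ n ^ 2 * ‖A‖ := by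
  have h1 : ∀ i, |v i| ≤ 1 := fun i => by
    have h : v i * v i ≤ ∑ i, v i * v i :=
      Finset.single_le_sum (f := fun i => v i * v i) (fun _ _ => mul_self_nonneg _)
        (Finset.mem_univ i)
    rw [dotProduct] at hv
    rw [hv] at h
    exact abs_le_one_iff_mul_self_le_one.mpr h
  calc |v ⬝ᵥ A *ᵥ v| = |∑ i, ∑ j, v i * (A i j * v j)| := by
        simp [dotProduct, mulVec, Finset.mul_sum]
    _ ≤ ∑ i, ∑ j, |v i * (A i j * v j)| :=
        (Finset.abs_sum_le_sum_abs _ _).trans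
          (Finset.sum_le_sum fun i _ => Finset.abs_sum_le_sum_abs _ _)
    _ ≤ ∑ _i : Fin n, ∑ _j : Fin n, ‖A‖ := by
        refine Finset.sum_le_sum fun i _ => Finset.sum_le_sum fun j _ => ?_
        rw [abs_mul, abs_mul]
        calc |v i| * (|A i j| * |v j|) ≤ 1 * (‖A‖ * 1) := by
              gcongr
              exacts [h1 i, abs_apply_le_norm A i j, h1 j]
          _ = ‖A‖ := by ring
    _ = n ^ 2 * ‖A‖ := by simp; ring

/-- A Weyl-type perturbation bound for the ordered eigenvalues of `1 + t S`. -/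
lemma abs_sortedEig_sub_le {C S : Matrix (Fin 3) (Fin 3) ℝ} (hC : C.IsHermitian)
    (hS : S.IsHermitian) {t : ℝ} (ht : 0 ≤ t) (i : Fin 3) :
    |sortedEig C i - (1 + t * sortedEig S i)| ≤ 21 * ‖C - 1 - t • S‖ := by
  set M := C - 1 - t • S with hM
  have hCM : ∀ v : Fin 3 → ℝ, v ⬝ᵥ v = 1 →
      v ⬝ᵥ C *ᵥ v = 1 + t * (v ⬝ᵥ S *ᵥ v) + v ⬝ᵥ M *ᵥ v := by
    intro v hv
    simp only [hM, sub_mulVec, one_mulVec, smul_mulVec, dotProduct_sub, dotProduct_smul, hv,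
      smul_eq_mul]
    ring
  have hMv : ∀ v : Fin 3 → ℝ, v ⬝ᵥ v = 1 →
      -(9 * ‖M‖) ≤ v ⬝ᵥ M *ᵥ v ∧ v ⬝ᵥ M *ᵥ v ≤ 9 * ‖M‖ := fun v hv => by
    have h := abs_dotProduct_mulVec_le_norm M hv
    norm_num at h
    exact abs_le.mp h
  have hCl := fun (v : Fin 3 → ℝ) (hv : v ⬝ᵥ v = 1) => le_dotProduct_mulVec hC (a := sortedEig C 0)
    (fun i => sortedEig_monotone hC (Fin.zero_le i)) v |>.trans_eq' (by rw [hv, mul_one])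
  have hSl := fun (v : Fin 3 → ℝ) (hv : v ⬝ᵥ v = 1) => le_dotProduct_mulVec hS (a := sortedEig S 0)
    (fun i => sortedEig_monotone hS (Fin.zero_le i)) v |>.trans_eq' (by rw [hv, mul_one])
  have hCu := fun (v : Fin 3 → ℝ) (hv : v ⬝ᵥ v = 1) => dotProduct_mulVec_le hC (a := sortedEig C 2)
    (fun i => sortedEig_monotone hC (Fin.le_last i)) v |>.trans_eq (by rw [hv, mul_one])
  have hSu := fun (v : Fin 3 → ℝ) (hv : v ⬝ᵥ v = 1) => dotProduct_mulVec_le hS (a := sortedEig S 2)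
    (fun i => sortedEig_monotone hS (Fin.le_last i)) v |>.trans_eq (by rw [hv, mul_one])
  have h0 : |sortedEig C 0 - (1 + t * sortedEig S 0)| ≤ 9 * ‖M‖ := by
    obtain ⟨v, hv, hv'⟩ := exists_unit_dotProduct_mulVec_eq_sortedEig hC 0
    obtain ⟨w, hw, hw'⟩ := exists_unit_dotProduct_mulVec_eq_sortedEig hS 0
    have e1 := hCM v hv
    have e2 := hCM w hw
    have i1 := mul_le_mul_of_nonneg_left (hSl v hv) ht
    have i2 := hCl w hw
    rw [hw'] at e2
    rw [abs_le]
    constructor <;> linarith [hMv v hv, hMv w hw]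
  have h2 : |sortedEig C 2 - (1 + t * sortedEig S 2)| ≤ 9 * ‖M‖ := by
    obtain ⟨v, hv, hv'⟩ := exists_unit_dotProduct_mulVec_eq_sortedEig hC 2
    obtain ⟨w, hw, hw'⟩ := exists_unit_dotProduct_mulVec_eq_sortedEig hS 2
    have e1 := hCM v hv
    have e2 := hCM w hw
    have i1 := mul_le_mul_of_nonneg_left (hSu v hv) ht
    have i2 := hCu w hw
    rw [hw'] at e2
    rw [abs_le]
    constructor <;> linarith [hMv v hv, hMv w hw]
  have htr : |C.trace - (3 + t * S.trace)| ≤ 3 * ‖M‖ := by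
    have h := abs_trace_le_norm M
    simp only [hM, trace_sub, trace_smul, trace_one, Fintype.card_fin, smul_eq_mul] at h
    rw [sub_sub] at h
    exact_mod_cast h
  have hcs := sum_sortedEig hC
  have hss := sum_sortedEig hS
  rw [Fin.sum_univ_three] at hcs hss
  rw [← hcs, ← hss] at htr
  have hMn := norm_nonneg M
  rw [abs_le] at h0 h2 htr ⊢
  fin_cases i <;> simp only [Fin.zero_eta, Fin.mk_one, Fin.reduceFinMk] <;>
    constructor <;> linarith

lemma mexp_eq_exp {n : ℕ} (A : Matrix (Fin n) (Fin n) ℝ) : mexp A = NormedSpace.exp A := by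
  rw [NormedSpace.exp_eq_tsum ℝ, mexp]

open Asymptotics in
lemma mexp_sub_isBigO (n : ℕ) :
    (fun A : Matrix (Fin n) (Fin n) ℝ => mexp A - (1 + A + (1 / 2 : ℝ) • (A * A)))
      =O[nhds 0] fun A => ‖A‖ ^ 3 := by
  have h := (NormedSpace.exp_hasFPowerSeriesAt_zero (𝕂 := ℝ)
    (𝔸 := Matrix (Fin n) (Fin n) ℝ)).isBigO_sub_partialSum_pow 3
  refine h.congr_left fun A => ?_
  rw [zero_add]
  refine (congrArg (· - _) (mexp_eq_exp A).symm).trans ?_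
  simp [FormalMultilinearSeries.partialSum, Finset.sum_range_succ, NormedSpace.expSeries_apply_eq,
    sq]

open Asymptotics in
lemma gram_mexp_isBigO {ι : Type*} {l : Filter ι} {n : ℕ} {e : ι → ℝ}
    {Z : ι → Matrix (Fin n) (Fin n) ℝ} (he : Tendsto e l (nhds 0))
    (hZ : Z =O[l] fun _ => (1 : ℝ)) :
    (fun p => (mexp (e p • Z p))ᵀ * mexp (e p • Z p) - 1 - (2 * e p) • msym (Z p) -
      e p ^ 2 • ((1 / 2 : ℝ) • (Z p * Z p + (Z p)ᵀ * (Z p)ᵀ) + (Z p)ᵀ * Z p))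
      =O[l] fun p => e p ^ 3 := by
  have htr : ∀ {f : ι → Matrix (Fin n) (Fin n) ℝ} {g : ι → ℝ}, f =O[l] g →
      (fun p => (f p)ᵀ) =O[l] g := fun h =>
    (isBigO_of_le l fun p => (frobenius_norm_transpose _).le).trans h
  have he1 : e =O[l] fun _ => (1 : ℝ) := he.isBigO_one ℝ
  have hmul : ∀ {f g : ι → Matrix (Fin n) (Fin n) ℝ} {u : ι → ℝ}, f =O[l] (fun _ => (1 : ℝ)) →
      g =O[l] u → (fun p => f p * g p) =O[l] u := fun hf hg => by
    simpa using hf.mul hg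
  have hmul' : ∀ {f g : ι → Matrix (Fin n) (Fin n) ℝ} {u : ι → ℝ}, f =O[l] u →
      g =O[l] (fun _ => (1 : ℝ)) → (fun p => f p * g p) =O[l] u := fun hf hg => by
    simpa using hf.mul hg
  have hsmul : ∀ {f : ι → ℝ} {g : ι → Matrix (Fin n) (Fin n) ℝ} {u : ι → ℝ}, f =O[l] u →
      g =O[l] (fun _ => (1 : ℝ)) → (fun p => f p • g p) =O[l] u := fun hf hg => by
    simpa using hf.smul hg
  have hpow : ∀ k, (fun p => e p ^ (k + 3)) =O[l] fun p => e p ^ 3 := fun k => by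
    simpa [pow_add] using (he1.pow k).mul (isBigO_refl (fun p => e p ^ 3) l)
  have heZ : (fun p => e p • Z p) =O[l] e := hsmul (isBigO_refl e l) hZ
  have hlim : Tendsto (fun p => e p • Z p) l (nhds 0) := heZ.trans_tendsto he
  set R := fun p => mexp (e p • Z p) -
    (1 + e p • Z p + (1 / 2 : ℝ) • ((e p • Z p) * (e p • Z p))) with hRdef
  have hR : R =O[l] fun p => e p ^ 3 :=
    ((mexp_sub_isBigO n).comp_tendsto hlim).trans (heZ.norm_left.pow 3)
  have hR1 : R =O[l] fun _ => (1 : ℝ) := hR.trans (by simpa using he1.pow 3)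
  set P := fun p => 1 + e p • Z p + (1 / 2 : ℝ) • ((e p • Z p) * (e p • Z p)) with hPdef
  have hP : P =O[l] fun _ => (1 : ℝ) := by
    have h1 := heZ.trans he1
    exact ((isBigO_const_const _ one_ne_zero l).add h1).add ((hmul h1 h1).const_smul_left (1 / 2 : ℝ))
  have hZt := htr hZ
  have hmain : (fun p => e p ^ 3 • ((1 / 2 : ℝ) • ((Z p)ᵀ * (Z p * Z p) + (Z p)ᵀ * (Z p)ᵀ * Z p))
      + e p ^ 4 • ((1 / 4 : ℝ) • ((Z p)ᵀ * (Z p)ᵀ * (Z p * Z p)))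
      + ((P p)ᵀ * R p + (R p)ᵀ * P p + (R p)ᵀ * R p)) =O[l] fun p => e p ^ 3 := by
    refine ((hsmul (hpow 0) ?_).add (hsmul (hpow 1) ?_)).add
      (((hmul (htr hP) hR).add (hmul' (htr hR) hP)).add (hmul (htr hR1) hR))
    · exact ((hmul hZt (hmul hZ hZ)).add (hmul (hmul hZt hZt) hZ)).const_smul_left (1 / 2 : ℝ)
    · exact (hmul (hmul hZt hZt) (hmul hZ hZ)).const_smul_left (1 / 4 : ℝ)
  refine hmain.congr_left fun p => ?_
  have hE : mexp (e p • Z p) = P p + R p := by simp [hPdef, hRdef]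
  rw [hE]
  simp only [hPdef, msym, transpose_add, transpose_mul, transpose_smul, transpose_one]
  simp only [Matrix.mul_add, Matrix.add_mul, smul_mul_assoc, mul_smul_comm, smul_add, one_mul,
    mul_one, Matrix.mul_assoc]
  module

open Asymptotics in
lemma exp_neg_two_mul_sub_isBigO {ι : Type*} {l : Filter ι} {e q : ι → ℝ}
    (he : Tendsto e l (nhds 0)) (hq : q =O[l] fun _ => (1 : ℝ)) :
    (fun p => (Real.exp (e p * q p) ^ 2)⁻¹ - (1 - 2 * e p * q p + 2 * e p ^ 2 * q p ^ 2))
      =O[l] fun p => e p ^ 3 := by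
  have heq : (fun p => -2 * (e p * q p)) =O[l] e := by
    simpa using ((isBigO_refl e l).mul hq).const_mul_left (-2)
  refine (((Real.exp_sub_sum_range_isBigO_pow 3).comp_tendsto
    (heq.trans_tendsto he)).trans (heq.pow 3)).congr_left fun p => ?_
  have : (Real.exp (e p * q p) ^ 2)⁻¹ = Real.exp (-2 * (e p * q p)) := by
    rw [← Real.exp_nat_mul, ← Real.exp_neg]
    congr 1
    push_cast
    ring
  rw [this]
  simp only [Function.comp, Finset.sum_range_succ, Finset.sum_range_zero, Nat.factorial]
  norm_num
  ring

open Asymptotics in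
lemma sortedEig_msym_isBigO_one {ι : Type*} {l : Filter ι} {n : ℕ}
    {Z : ι → Matrix (Fin n) (Fin n) ℝ} (hZ : Z =O[l] fun _ => (1 : ℝ)) (i : Fin n) :
    (fun p => sortedEig (msym (Z p)) i) =O[l] fun _ => (1 : ℝ) := by
  have hS : (fun p => msym (Z p)) =O[l] fun _ => (1 : ℝ) := by
    refine (hZ.add ?_).const_smul_left (1 / 2 : ℝ)
    exact (isBigO_of_le l fun p => (frobenius_norm_transpose _).le).trans hZ
  refine (IsBigO.of_bound (n ^ 2) (Eventually.of_forall fun p => ?_)).trans hS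
  obtain ⟨v, hv, hv'⟩ := exists_unit_dotProduct_mulVec_eq_sortedEig (isHermitian_msym (Z p)) i
  rw [← hv']
  exact abs_dotProduct_mulVec_le_norm (msym (Z p)) hv

open Asymptotics in
lemma rescaled_energy_sub_isBigO {ι : Type*} {l : Filter ι} {e : ι → ℝ}
    {Z : ι → Matrix (Fin 3) (Fin 3) ℝ} {q : Fin 3 → ι → ℝ} (he : Tendsto e l (nhds 0))
    (hpos : ∀ᶠ p in l, 0 < e p) (hZ : Z =O[l] fun _ => (1 : ℝ))
    (htrace : ∀ᶠ p in l, (Z p).trace = 0) (hq : ∀ i, q i =O[l] fun _ => (1 : ℝ))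
    (hsum : ∀ᶠ p in l, q 0 p + q 1 p + q 2 p = 0) :
    (fun p => ((∑ i, singVals (mexp (e p • Z p)) i ^ 2 / Real.exp (e p * q i p) ^ 2) - 3) / e p ^ 2
      - 2 * ∑ i, (sortedEig (msym (Z p)) i - q i p) ^ 2) =O[l] e := by
  set C := fun p => (mexp (e p • Z p))ᵀ * mexp (e p • Z p) with hCdef
  have hC : ∀ p, (C p).IsHermitian := fun p => by
    simpa [conjTranspose_eq_transpose_of_trivial] using
      isHermitian_conjTranspose_mul_self (mexp (e p • Z p))
  have he1 : e =O[l] fun _ => (1 : ℝ) := he.isBigO_one ℝ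
  have hT := gram_mexp_isBigO he hZ
  set Q := fun p => (1 / 2 : ℝ) • (Z p * Z p + (Z p)ᵀ * (Z p)ᵀ) + (Z p)ᵀ * Z p with hQdef
  have hQ : Q =O[l] fun _ => (1 : ℝ) := by
    have hZt : (fun p => (Z p)ᵀ) =O[l] fun _ => (1 : ℝ) :=
      (isBigO_of_le l fun p => (frobenius_norm_transpose _).le).trans hZ
    have h := (((hZ.mul hZ).add (hZt.mul hZt)).const_smul_left (1 / 2 : ℝ)).add (hZt.mul hZ)
    simp only [mul_one] at h
    exact h
  set a := fun i p => sortedEig (C p) i - (1 + 2 * e p * sortedEig (msym (Z p)) i) with hadef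
  have ha : ∀ i, a i =O[l] fun p => e p ^ 2 := fun i => by
    have h1 : (fun p => C p - 1 - (2 * e p) • msym (Z p)) =O[l] fun p => e p ^ 2 := by
      have h2 : (fun p => e p ^ 2 • Q p) =O[l] fun p => e p ^ 2 := by
        simpa using (isBigO_refl (fun p => e p ^ 2) l).smul hQ
      have h3 : (fun p => e p ^ 3) =O[l] fun p => e p ^ 2 := by
        exact ((isBigO_refl (fun p => e p ^ 2) l).mul he1).congr (fun p => by ring)
          fun p => by ring
      exact ((hT.trans h3).add h2).congr_left fun p => sub_add_cancel _ _
    refine (IsBigO.of_bound 21 ?_).trans h1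
    filter_upwards [hpos] with p hp
    exact abs_sortedEig_sub_le (hC p) (isHermitian_msym _) (by positivity) i
  have hlam := sortedEig_msym_isBigO_one hZ
  set b := fun p => (C p).trace - 3 - 2 * e p ^ 2 * ∑ i, sortedEig (msym (Z p)) i ^ 2 with hbdef
  have hb : b =O[l] fun p => e p ^ 3 := by
    refine (IsBigO.of_bound 3 ?_).trans hT
    filter_upwards [htrace] with p hp
    have h := abs_trace_le_norm (C p - 1 - (2 * e p) • msym (Z p) - e p ^ 2 • Q p)
    refine le_of_eq_of_le ?_ h
    rw [Real.norm_eq_abs]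
    congr 1
    simp only [hbdef]
    rw [sum_sortedEig_sq (isHermitian_msym _)]
    have hcomm : (Z p * (Z p)ᵀ).trace = ((Z p)ᵀ * Z p).trace := trace_mul_comm _ _
    simp [hQdef, msym, hp, Matrix.mul_add, Matrix.add_mul, hcomm]
    ring
  have hexp := fun i => exp_neg_two_mul_sub_isBigO he (hq i)
  set t := fun i p => (Real.exp (e p * q i p) ^ 2)⁻¹ -
    (1 - 2 * e p * q i p + 2 * e p ^ 2 * q i p ^ 2) with htdef
  have hc1 : ∀ i, (fun p => sortedEig (C p) i) =O[l] fun _ => (1 : ℝ) := fun i => by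
    have h1 : (fun p => 1 + 2 * e p * sortedEig (msym (Z p)) i) =O[l] fun _ => (1 : ℝ) := by
      have h := (he1.const_mul_left 2).mul (hlam i)
      simp only [mul_one] at h
      exact (isBigO_refl (fun _ => (1 : ℝ)) l).add h
    have h2 : a i =O[l] fun _ => (1 : ℝ) := (ha i).trans (by simpa using he1.pow 2)
    simpa [hadef] using h2.add h1
  have hterm : ∀ i, (fun p => -2 * (e p * q i p * a i p)
      + (2 * q i p ^ 2) * (2 * e p ^ 3 * sortedEig (msym (Z p)) i + e p ^ 2 * a i p)
      + t i p * sortedEig (C p) i) =O[l] fun p => e p ^ 3 := fun i => by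
    have h1 : (fun p => -2 * (e p * q i p * a i p)) =O[l] fun p => e p ^ 3 := by
      refine ((((isBigO_refl e l).mul (hq i)).mul (ha i)).const_mul_left (-2)).congr_right
        fun p => by ring
    have h2 : (fun p => 2 * e p ^ 3 * sortedEig (msym (Z p)) i) =O[l] fun p => e p ^ 3 := by
      simpa using ((isBigO_refl (fun p => e p ^ 3) l).const_mul_left 2).mul (hlam i)
    have h3 : (fun p => e p ^ 2 * a i p) =O[l] fun p => e p ^ 3 := by
      refine ((isBigO_refl (fun p => e p ^ 2) l).mul (ha i)).trans ?_
      refine ((isBigO_refl (fun p => e p ^ 3) l).mul he1).congr (fun p => by ring)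
        fun p => by ring
    have h4 : (fun p => 2 * q i p ^ 2) =O[l] fun _ => (1 : ℝ) := by
      simpa using ((hq i).pow 2).const_mul_left 2
    have h5 : (fun p => t i p * sortedEig (C p) i) =O[l] fun p => e p ^ 3 := by
      simpa using (hexp i).mul (hc1 i)
    have h6 := h4.mul (h2.add h3)
    simp only [one_mul] at h6
    exact (h1.add h6).add h5
  have htotal := hb.add (IsBigO.fun_sum (s := Finset.univ) fun i _ => hterm i)
  have hdiv := (isBigO_refl (fun p => (e p ^ 2)⁻¹) l).mul htotal
  refine hdiv.congr' ?_ ?_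
  · filter_upwards [hpos, hsum] with p hp hs
    have hne : e p ≠ 0 := hp.ne'
    have htr := sum_sortedEig (hC p)
    rw [Fin.sum_univ_three] at htr
    have hd : ∀ i, singVals (mexp (e p • Z p)) i ^ 2 / Real.exp (e p * q i p) ^ 2 =
        sortedEig (C p) i * (t i p + (1 - 2 * e p * q i p + 2 * e p ^ 2 * q i p ^ 2)) := fun i => by
      simp only [htdef, hCdef, singVals_sq]
      ring
    simp only [hd]
    simp only [Fin.sum_univ_three, hbdef, ← htr, hadef]
    have hs' : q 2 p = -(q 0 p + q 1 p) := by linarith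
    field_simp
    rw [hs']
    ring
  · filter_upwards [hpos] with p hp
    have hne : e p ≠ 0 := hp.ne'
    field_simp

end FrobeniusNorm

/-- Uniform-on-compacts convergence of the rescaled nematic elastomer energies
`V_ε(Z) = ε⁻² W_ε(e^{εZ})` to the linearized density `2 Σ (λ_i(Z_sym) − ρ_i)²`. -/
theorem stmt11 (ρ : Fin 3 → ℝ) (ρε : Fin 3 → ℝ → ℝ)
    (hconv : ∀ i, Filter.Tendsto (fun ε => ρε i ε) (nhdsWithin 0 (Set.Ioi 0)) (nhds (ρ i)))
    (hsum : ∀ ε : ℝ, 0 < ε → ρε 0 ε + ρε 1 ε + ρε 2 ε = 0) :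
    ∀ r > (0 : ℝ), ∀ δ > (0 : ℝ), ∃ ε₁ > (0 : ℝ), ∀ ε : ℝ, 0 < ε → ε ≤ ε₁ →
      ∀ Z : Matrix (Fin 3) (Fin 3) ℝ, Z.trace = 0 → frob Z ≤ r →
        |((∑ i, (singVals (mexp (ε • Z)) i) ^ 2 / (Real.exp (ε * ρε i ε)) ^ 2) - 3) / ε ^ 2
          - 2 * ∑ i, (sortedEig (msym Z) i - ρ i) ^ 2| ≤ δ := by
  intro r _ δ hδ
  let _ : NormedRing (Matrix (Fin 3) (Fin 3) ℝ) := Matrix.frobeniusNormedRing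
  set l : Filter (ℝ × Matrix (Fin 3) (Fin 3) ℝ) :=
    nhdsWithin 0 (Set.Ioi 0) ×ˢ Filter.principal {Z | Z.trace = 0 ∧ frob Z ≤ r} with hl
  have hfst : Tendsto Prod.fst l (nhdsWithin (0 : ℝ) (Set.Ioi 0)) := tendsto_fst
  have hsnd : ∀ᶠ p in l, p.2.trace = 0 ∧ frob p.2 ≤ r :=
    tendsto_snd.eventually (mem_principal_self _)
  have hpos : ∀ᶠ p in l, 0 < p.1 := hfst.eventually self_mem_nhdsWithin
  have he : Tendsto (fun p : ℝ × Matrix (Fin 3) (Fin 3) ℝ => p.1) l (nhds 0) :=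
    hfst.mono_right nhdsWithin_le_nhds
  have hq : ∀ i, Tendsto (fun p => ρε i p.1) l (nhds (ρ i)) := fun i => (hconv i).comp hfst
  have hZ : (fun p => p.2) =O[l] fun _ => (1 : ℝ) := by
    refine Asymptotics.IsBigO.of_bound r ?_
    filter_upwards [hsnd] with p hp
    simpa [norm_eq_frob] using hp.2
  have hlam : ∀ i, (fun p => sortedEig (msym p.2) i) =O[l] fun _ => (1 : ℝ) :=
    fun i => sortedEig_msym_isBigO_one hZ i
  have h1 := (rescaled_energy_sub_isBigO he hpos hZ (hsnd.mono fun _ h => h.1)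
    (fun i => (hq i).isBigO_one ℝ) (hpos.mono fun p hp => hsum p.1 hp)).trans_tendsto he
  have h2 : ∀ i, Tendsto (fun p => (sortedEig (msym p.2) i - ρε i p.1) ^ 2
      - (sortedEig (msym p.2) i - ρ i) ^ 2) l (nhds 0) := fun i => by
    have h3 : Tendsto (fun p => ρ i - ρε i p.1) l (nhds 0) := by
      simpa using (hq i).const_sub (ρ i)
    have h4 := ((hlam i).const_mul_left 2).sub
      (((hq i).isBigO_one ℝ).add (Asymptotics.isBigO_const_const (ρ i) one_ne_zero l))
    refine (((Asymptotics.isBigO_refl _ l).mul h4).trans_tendsto (by simpa using h3)).congr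
      fun p => by ring
  have h5 := h1.add ((tendsto_finsetSum Finset.univ fun i _ => h2 i).const_mul 2)
  have h6 := (h5.abs.eventually_lt_const (u := δ) (by simpa using hδ))
  rw [hl, eventually_prod_principal_iff] at h6
  obtain ⟨u, hu, hsub⟩ := mem_nhdsGT_iff_exists_Ioc_subset.mp h6
  refine ⟨u, hu, fun ε hε hεu Z hZ0 hZr => ?_⟩
  refine le_of_eq_of_le ?_ (hsub ⟨hε, hεu⟩ Z ⟨hZ0, hZr⟩).le
  congr 1
  rw [Finset.sum_sub_distrib]
  ring
end
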